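/- There exists an absolute constant c > 0 such that for all integers k ≥ 2, n ≥ 3k: any length-n ROBP over alphabet [k] that computes ApproxCount_k[n, n/(3(k−1))] has width w satisfying log₂ w ≥ c · k · log₂(n/k). -/

import Mathlib

open Finset

/-- A length-`n` read-once branching program over alphabet `σ` with outputs in `Out`.
Layer `t` has vertex set `Fin (size t)` (only layers `0, 1, …, n` are relevant);
layer `0` consists of a single start vertex, and each vertex of layer `t` has an
outgoing edge to layer `t+1` for every letter of the alphabet. -/
structure ROBP (σ Out : Type) (n : ℕ) where
  size : ℕ → ℕ
  size0 : size 0 = 1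
  sizePos : ∀ t, 0 < size t
  step : (t : ℕ) → Fin (size t) → σ → Fin (size (t + 1))
  out : Fin (size n) → Out

namespace ROBP

variable {σ Out : Type} {n : ℕ}

/-- The vertex reached in layer `t` on input `x` (only `x 0, …, x (t-1)` matter). -/
def state (P : ROBP σ Out n) (x : ℕ → σ) : (t : ℕ) → Fin (P.size t)
  | 0 => ⟨0, P.sizePos 0⟩
  | t + 1 => P.step t (state P x t) (x t)

/-- The width of an ROBP: the maximal number of vertices in a single layer. -/
def width (P : ROBP σ Out n) : ℕ := (Finset.range (n + 1)).sup P.size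

/-- Every vertex (in the relevant layers) is reached by some input: no useless vertices. -/
def Reachable (P : ROBP σ Out n) : Prop :=
  ∀ t, t ≤ n → ∀ v : Fin (P.size t), ∃ x : ℕ → σ, P.state x t = v

/-- The output of the program on input `x`. -/
def eval (P : ROBP σ Out n) (x : ℕ → σ) : Out := P.out (P.state x n)

end ROBP

/-- The number of occurrences of `j` among `x 0, …, x (t-1)`. -/
def countK {k : ℕ} (x : ℕ → Fin k) (t : ℕ) (j : Fin k) : ℕ :=
  ((Finset.range t).filter fun i => x i = j).card

/-- `P` computes `ApproxCount_k[n, Δ]`: on every input, each of the `k` outputs estimates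
the frequency of the corresponding letter within additive error `Δ`. -/
def ComputesApproxCountK (k n : ℕ) (Δ : ℝ) (P : ROBP (Fin k) (Fin k → ℝ) n) : Prop :=
  ∀ x : ℕ → Fin k, ∀ j : Fin k, |P.eval x j - (countK x n j : ℝ)| ≤ Δ

/-- `P` computes `ApproxCount[n, Δ]` (the `{0,1}` case). -/
def ComputesApproxCount (n : ℕ) (Δ : ℝ) (P : ROBP Bool ℝ n) : Prop :=
  ∀ x : ℕ → Bool, |P.eval x - (((Finset.range n).filter fun i => x i = true).card : ℝ)| ≤ Δ

/-- The number of `1`'s in coordinate `j` among `x 0, …, x (t-1)`. -/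
def countPar {k : ℕ} (x : ℕ → (Fin k → Bool)) (t : ℕ) (j : Fin k) : ℕ :=
  ((Finset.range t).filter fun i => x i j = true).card

/-- `P` computes `ApproxCount^par_k[n, Δ]`. -/
def ComputesApproxCountPar (k n : ℕ) (Δ : ℝ) (P : ROBP (Fin k → Bool) (Fin k → ℝ) n) : Prop :=
  ∀ x : ℕ → (Fin k → Bool), ∀ j : Fin k, |P.eval x j - (countPar x n j : ℝ)| ≤ Δ

/-- The inclusion `[k-1] ⊆ [k]`. -/
def idx {k : ℕ} (j : Fin (k - 1)) : Fin k := Fin.castLE (Nat.sub_le k 1) j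

/-- `a_j(v)`: the minimal possible number of `j`'s in the first `t` input words
reaching the vertex `v` of layer `t`. -/
noncomputable def rectLo {k n : ℕ} (P : ROBP (Fin k) (Fin k → ℝ) n) (t : ℕ)
    (v : Fin (P.size t)) (j : Fin (k - 1)) : ℕ :=
  sInf {c | ∃ x : ℕ → Fin k, P.state x t = v ∧ countK x t (idx j) = c}

/-- `b_j(v)`: the maximal possible number of `j`'s in the first `t` input words
reaching the vertex `v` of layer `t`. -/
noncomputable def rectHi {k n : ℕ} (P : ROBP (Fin k) (Fin k → ℝ) n) (t : ℕ)
    (v : Fin (P.size t)) (j : Fin (k - 1)) : ℕ :=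
  sSup {c | ∃ x : ℕ → Fin k, P.state x t = v ∧ countK x t (idx j) = c}

/-- `a_j(v)` for the `k`-parallel case. -/
noncomputable def parLo {k n : ℕ} (P : ROBP (Fin k → Bool) (Fin k → ℝ) n) (t : ℕ)
    (v : Fin (P.size t)) (j : Fin k) : ℕ :=
  sInf {c | ∃ x : ℕ → (Fin k → Bool), P.state x t = v ∧ countPar x t j = c}

/-- `b_j(v)` for the `k`-parallel case. -/
noncomputable def parHi {k n : ℕ} (P : ROBP (Fin k → Bool) (Fin k → ℝ) n) (t : ℕ)
    (v : Fin (P.size t)) (j : Fin k) : ℕ :=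
  sSup {c | ∃ x : ℕ → (Fin k → Bool), P.state x t = v ∧ countPar x t j = c}

/-- The axis-parallel box `[lo 1, hi 1] × ⋯ × [lo m, hi m]` (as a set of integer points). -/
def rect {m : ℕ} (lo hi : Fin m → ℕ) : Set (Fin m → ℕ) :=
  {y | ∀ j, lo j ≤ y j ∧ y j ≤ hi j}

/-- The potential `φ_t(x)` of the point `x` (k-counter case): the maximum, over all
rectangle labels of layer `t` containing `x`, of `min{Σ_j b_j, t} - Σ_j x_j`. -/
noncomputable def phiK {k n : ℕ} (P : ROBP (Fin k) (Fin k → ℝ) n) (t : ℕ)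
    (x : Fin (k - 1) → ℕ) : ℕ :=
  Finset.univ.sup fun v : Fin (P.size t) =>
    if ∀ j, rectLo P t v j ≤ x j ∧ x j ≤ rectHi P t v j then
      min (∑ j, rectHi P t v j) t - ∑ j, x j
    else 0

/-- `T_{t,k}`: tuples of naturals summing to at most `t`. -/
def Tset (k t : ℕ) : Finset (Fin (k - 1) → ℕ) :=
  (Fintype.piFinset fun _ => Finset.range (t + 1)).filter fun x => ∑ j, x j ≤ t

/-- The total potential `Φ_t` of layer `t` (k-counter case). -/
noncomputable def PhiK {k n : ℕ} (P : ROBP (Fin k) (Fin k → ℝ) n) (t : ℕ) : ℕ :=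
  ∑ x ∈ Tset k t, phiK P t x

/-- The potential `φ_t(x)` of the point `x` (k-parallel case). -/
noncomputable def phiPar {k n : ℕ} (P : ROBP (Fin k → Bool) (Fin k → ℝ) n) (t : ℕ)
    (x : Fin k → ℕ) : ℕ :=
  Finset.univ.sup fun v : Fin (P.size t) =>
    if ∀ j, parLo P t v j ≤ x j ∧ x j ≤ parHi P t v j then
      (∑ j, parHi P t v j) - ∑ j, x j
    else 0

/-- The total potential `Φ_t` of layer `t` (k-parallel case): the sum of `φ_t(x)`
over `x ∈ {0, 1, …, ⌊n/10⌋}^k`. -/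
noncomputable def PhiPar {k n : ℕ} (P : ROBP (Fin k → Bool) (Fin k → ℝ) n) (t : ℕ) : ℕ :=
  ∑ x ∈ Fintype.piFinset (fun _ : Fin k => Finset.range (n / 10 + 1)), phiPar P t x

/-- The generalized binomial coefficient `C(x, m) = x (x-1) ⋯ (x-m+1) / m!`. -/
noncomputable def genChoose (x : ℝ) (m : ℕ) : ℝ :=
  (∏ i ∈ Finset.range m, (x - (i : ℝ))) / (Nat.factorial m : ℝ)

namespace ROBP

variable {σ Out : Type} {n : ℕ}

/-- The state in layer `t` depends only on the first `t` letters. -/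
theorem state_congr (P : ROBP σ Out n) {x y : ℕ → σ} {t : ℕ} (h : ∀ i < t, x i = y i) :
    P.state x t = P.state y t := by
  induction t with
  | zero => rfl
  | succ t ih =>
    simp only [state, ih fun i hi => h i (hi.trans t.lt_succ_self), h t t.lt_succ_self]

theorem state_update_succ (P : ROBP σ Out n) (x : ℕ → σ) (t : ℕ) (s : σ) :
    P.state (Function.update x t s) (t + 1) = P.step t (P.state x t) s := by
  have h : P.state (Function.update x t s) t = P.state x t :=
    P.state_congr fun i hi => Function.update_of_ne hi.ne _ _
  simp only [state, h, Function.update_self]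

theorem size_le_width (P : ROBP σ Out n) {t : ℕ} (ht : t ≤ n) : P.size t ≤ P.width :=
  Finset.le_sup (f := P.size) (Finset.mem_range.2 (Nat.lt_succ_of_le ht))

end ROBP

theorem countK_update_succ {k : ℕ} (x : ℕ → Fin k) (t : ℕ) (s j : Fin k) :
    countK (Function.update x t s) (t + 1) j = countK x t j + if s = j then 1 else 0 := by
  have h : (Finset.range t).filter (fun i => Function.update x t s i = j)
      = (Finset.range t).filter (fun i => x i = j) :=
    Finset.filter_congr fun i hi => by
      rw [Function.update_of_ne (Finset.mem_range.1 hi).ne]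
  unfold countK
  rw [Finset.range_add_one, Finset.filter_insert, h, Function.update_self]
  split_ifs <;> simp

theorem countK_le {k : ℕ} (x : ℕ → Fin k) (t : ℕ) (j : Fin k) : countK x t j ≤ t :=
  (Finset.card_filter_le _ _).trans (Finset.card_range t).le

theorem idx_injective {k : ℕ} : Function.Injective (idx : Fin (k - 1) → Fin k) :=
  Fin.castLE_injective (Nat.sub_le k 1)

theorem exists_ne_idx {k : ℕ} (hk : 0 < k) : ∃ s : Fin k, ∀ j, s ≠ idx j := by
  refine ⟨⟨k - 1, by omega⟩, fun j h => ?_⟩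
  have h' := congrArg Fin.val h
  have hj := j.isLt
  simp only [idx, Fin.val_castLE] at h'
  omega

section Rectangles

variable {k n : ℕ} (P : ROBP (Fin k) (Fin k → ℝ) n)

theorem rectLo_le (x : ℕ → Fin k) (t : ℕ) (j : Fin (k - 1)) :
    rectLo P t (P.state x t) j ≤ countK x t (idx j) :=
  Nat.sInf_le ⟨x, rfl, rfl⟩

theorem bddAbove_counts (t : ℕ) (v : Fin (P.size t)) (j : Fin (k - 1)) :
    BddAbove {c | ∃ x : ℕ → Fin k, P.state x t = v ∧ countK x t (idx j) = c} :=
  ⟨t, by rintro _ ⟨x, -, rfl⟩; exact countK_le x t _⟩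

theorem le_rectHi (x : ℕ → Fin k) (t : ℕ) (j : Fin (k - 1)) :
    countK x t (idx j) ≤ rectHi P t (P.state x t) j :=
  le_csSup (bddAbove_counts P t _ j) ⟨x, rfl, rfl⟩

variable {P}

theorem exists_countK_eq_rectLo (hP : P.Reachable) {t : ℕ} (ht : t ≤ n) (v : Fin (P.size t))
    (j : Fin (k - 1)) : ∃ x, P.state x t = v ∧ countK x t (idx j) = rectLo P t v j := by
  obtain ⟨x, hx⟩ := hP t ht v
  exact Nat.sInf_mem (s := {c | ∃ x : ℕ → Fin k, P.state x t = v ∧ countK x t (idx j) = c})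
    ⟨_, x, hx, rfl⟩

theorem exists_countK_eq_rectHi (hP : P.Reachable) {t : ℕ} (ht : t ≤ n) (v : Fin (P.size t))
    (j : Fin (k - 1)) : ∃ x, P.state x t = v ∧ countK x t (idx j) = rectHi P t v j := by
  obtain ⟨x, hx⟩ := hP t ht v
  exact Nat.sSup_mem (s := {c | ∃ x : ℕ → Fin k, P.state x t = v ∧ countK x t (idx j) = c})
    ⟨_, x, hx, rfl⟩ (bddAbove_counts P t v j)

theorem rectLo_step_le (hP : P.Reachable) {t : ℕ} (ht : t ≤ n) (v : Fin (P.size t)) (s : Fin k)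
    (j : Fin (k - 1)) :
    rectLo P (t + 1) (P.step t v s) j ≤ rectLo P t v j + if s = idx j then 1 else 0 := by
  obtain ⟨x, rfl, hx⟩ := exists_countK_eq_rectLo hP ht v j
  rw [← hx, ← countK_update_succ, ← P.state_update_succ]
  exact rectLo_le P _ _ _

theorem le_rectHi_step (hP : P.Reachable) {t : ℕ} (ht : t ≤ n) (v : Fin (P.size t)) (s : Fin k)
    (j : Fin (k - 1)) :
    (rectHi P t v j + if s = idx j then 1 else 0) ≤ rectHi P (t + 1) (P.step t v s) j := by
  obtain ⟨x, rfl, hx⟩ := exists_countK_eq_rectHi hP ht v j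
  rw [← hx, ← countK_update_succ, ← P.state_update_succ]
  exact le_rectHi P _ _ _

/-- Every point with coordinate sum at most `t` lies in some rectangle of layer `t`. -/
theorem exists_mem_rect (hk : 0 < k) (hP : P.Reachable) {t : ℕ} (ht : t ≤ n)
    {x : Fin (k - 1) → ℕ} (hx : ∑ j, x j ≤ t) :
    ∃ v, x ∈ rect (rectLo P t v) (rectHi P t v) := by
  induction t generalizing x with
  | zero =>
    obtain ⟨s, -⟩ := exists_ne_idx hk
    have h0 : ∀ j, x j = 0 := by simpa using hx
    refine ⟨P.state (fun _ => s) 0, fun j => ?_⟩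
    have := rectLo_le P (fun _ => s) 0 j
    have := countK_le (fun _ => s) 0 (idx j)
    have := h0 j
    omega
  | succ t ih =>
    by_cases hxt : ∑ j, x j ≤ t
    · obtain ⟨v, hv⟩ := ih (by omega) hxt
      obtain ⟨s, hs⟩ := exists_ne_idx hk
      refine ⟨P.step t v s, fun j => ?_⟩
      have h1 := rectLo_step_le hP (by omega) v s j
      have h2 := le_rectHi_step hP (by omega) v s j
      have := hv j
      simp only [hs j, if_false] at h1 h2
      omega
    · obtain ⟨i, -, hi⟩ := Finset.exists_ne_zero_of_sum_ne_zero (show ∑ j, x j ≠ 0 by omega)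
      have hsum : ∑ j, (Function.update x i (x i - 1)) j ≤ t := by
        have h1 := Finset.sum_update_of_mem (Finset.mem_univ i) x (x i - 1)
        have h2 := Finset.sum_eq_add_sum_sdiff_singleton_of_mem (Finset.mem_univ i) x
        omega
      obtain ⟨v, hv⟩ := ih (by omega) hsum
      refine ⟨P.step t v (idx i), fun j => ?_⟩
      have h1 := rectLo_step_le hP (by omega) v (idx i) j
      have h2 := le_rectHi_step hP (by omega) v (idx i) j
      have := hv j
      by_cases hij : i = j
      · subst hij
        simp only [if_true, Function.update_self] at h1 h2 this
        omega
      · simp only [idx_injective.eq_iff, hij, if_false,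
          Function.update_of_ne (Ne.symm hij)] at h1 h2 this
        omega

theorem le_phiK {t : ℕ} {v : Fin (P.size t)} {x : Fin (k - 1) → ℕ}
    (hv : x ∈ rect (rectLo P t v) (rectHi P t v)) :
    min (∑ j, rectHi P t v j) t - ∑ j, x j ≤ phiK P t x := by
  unfold phiK
  refine le_trans ?_ (Finset.le_sup (Finset.mem_univ v))
  simp only [rect, Set.mem_ofPred_eq] at hv
  rw [if_pos hv]

theorem phiK_le_iff {t : ℕ} {x : Fin (k - 1) → ℕ} {c : ℕ} :
    phiK P t x ≤ c ↔ ∀ v, x ∈ rect (rectLo P t v) (rectHi P t v) →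
      min (∑ j, rectHi P t v j) t - ∑ j, x j ≤ c := by
  unfold phiK
  simp only [Finset.sup_le_iff, rect, Set.mem_ofPred_eq]
  refine ⟨fun h v hv => ?_, fun h v _ => ?_⟩
  · have := h v (Finset.mem_univ v)
    rwa [if_pos hv] at this
  · split_ifs with hv
    · exact h v hv
    · exact Nat.zero_le c

theorem phiK_le_succ (hk : 0 < k) (hP : P.Reachable) {t : ℕ} (ht : t ≤ n) (x : Fin (k - 1) → ℕ) :
    phiK P t x ≤ phiK P (t + 1) x := by
  refine phiK_le_iff.2 fun v hv => ?_
  obtain ⟨s, hs⟩ := exists_ne_idx hk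
  have h1 j := rectLo_step_le hP ht v s j
  have h2 j := le_rectHi_step hP ht v s j
  simp only [hs, if_false, add_zero] at h1 h2
  refine le_trans ?_ (le_phiK (v := P.step t v s) fun j =>
    ⟨(h1 j).trans (hv j).1, (hv j).2.trans (h2 j)⟩)
  have := Finset.sum_le_sum fun j (_ : j ∈ Finset.univ) => h2 j
  omega

/-- The potential of a point increases strictly unless the point is the lower corner of a
rectangle. -/
theorem phiK_lt_succ (hk : 0 < k) (hP : P.Reachable) {t : ℕ} (ht : t ≤ n) {x : Fin (k - 1) → ℕ}
    (hx : ∑ j, x j ≤ t) (hlo : ∀ v, rectLo P t v ≠ x) :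
    phiK P t x < phiK P (t + 1) x := by
  have key v (hv : x ∈ rect (rectLo P t v) (rectHi P t v)) :
      min (∑ j, rectHi P t v j) t - ∑ j, x j + 1 ≤ phiK P (t + 1) x := by
    obtain ⟨i, hi⟩ := Function.ne_iff.1 (hlo v)
    have h1 j := rectLo_step_le hP ht v (idx i) j
    have h2 j := le_rectHi_step hP ht v (idx i) j
    simp only [idx_injective.eq_iff] at h1 h2
    refine le_trans ?_ (le_phiK (v := P.step t v (idx i)) fun j => ?_)
    · have h3 := Finset.sum_le_sum fun j (_ : j ∈ Finset.univ) => h2 j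
      have h4 := Finset.sum_le_sum fun j (_ : j ∈ Finset.univ) => (hv j).2
      rw [Finset.sum_add_distrib, Finset.sum_ite_eq, if_pos (Finset.mem_univ i)] at h3
      omega
    · have := h1 j
      have := h2 j
      have := hv j
      split_ifs at * with hij
      · subst hij; omega
      · omega
  obtain ⟨v, hv⟩ := exists_mem_rect hk hP ht hx
  have hpos : 1 ≤ phiK P (t + 1) x := le_trans (Nat.le_add_left 1 _) (key v hv)
  have : phiK P t x ≤ phiK P (t + 1) x - 1 :=
    phiK_le_iff.2 fun v hv => Nat.le_sub_one_of_lt (key v hv)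
  omega

theorem sum_sub_le_width_mul_add_sum_phiK (hk : 0 < k) (hP : P.Reachable)
    (S : Finset (Fin (k - 1) → ℕ)) {t : ℕ} (ht : t ≤ n) :
    ∑ x ∈ S, (t - ∑ j, x j) ≤ t * P.width + ∑ x ∈ S, phiK P t x := by
  classical
  induction t with
  | zero => simp
  | succ t ih =>
    have ih := ih (by omega)
    let C := Finset.univ.image (rectLo P t)
    have hC : C.card ≤ P.width :=
      Finset.card_image_le.trans (by simpa using P.size_le_width (by omega : t ≤ n))
    have hpt : ∀ x ∈ S, (t + 1 - ∑ j, x j) + phiK P t x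
        ≤ (t - ∑ j, x j) + phiK P (t + 1) x + if x ∈ C then 1 else 0 := by
      intro x _
      have hmono := phiK_le_succ hk hP (by omega : t ≤ n) x
      by_cases hx : ∑ j, x j ≤ t
      · split_ifs with hxC
        · omega
        · have := phiK_lt_succ hk hP (by omega : t ≤ n) hx
            (fun v hv => hxC (Finset.mem_image.2 ⟨v, Finset.mem_univ v, hv⟩))
          omega
      · omega
    have hsum := Finset.sum_le_sum hpt
    simp only [Finset.sum_add_distrib] at hsum
    have hcard : ∑ x ∈ S, (if x ∈ C then 1 else 0) ≤ P.width := by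
      rw [← Finset.card_filter]
      refine le_trans (Finset.card_le_card fun x hx => ?_) hC
      exact (Finset.mem_filter.1 hx).2
    rw [add_mul, one_mul]
    omega

/-- Two inputs with the same final state have nearly the same letter counts. -/
theorem countK_le_of_state_eq (hk : 2 ≤ k)
    (hA : ComputesApproxCountK k n ((n : ℝ) / (3 * ((k : ℝ) - 1))) P) {x y : ℕ → Fin k}
    (hxy : P.state x n = P.state y n) (j : Fin k) :
    3 * (k - 1) * countK x n j ≤ 2 * n + 3 * (k - 1) * countK y n j := by
  have h1 := abs_le.1 (hA x j)
  have h2 := abs_le.1 (hA y j)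
  rw [ROBP.eval, hxy, ← ROBP.eval] at h1
  have hk' : (0 : ℝ) < 3 * ((k : ℝ) - 1) := by
    have : (2 : ℝ) ≤ k := by exact_mod_cast hk
    linarith
  have h3 : (countK x n j : ℝ) - countK y n j ≤ 2 * n / (3 * ((k : ℝ) - 1)) := by
    rw [mul_div_assoc]
    linarith [h1.1, h2.2]
  rw [le_div_iff₀ hk'] at h3
  have : (3 * ((k - 1 : ℕ) : ℝ) * countK x n j) ≤ 2 * n + 3 * ((k - 1 : ℕ) : ℝ) * countK y n j := by
    rw [Nat.cast_sub (by omega : 1 ≤ k), Nat.cast_one]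
    linarith
  exact_mod_cast this

theorem phiK_final_le (hk : 2 ≤ k) (hP : P.Reachable)
    (hA : ComputesApproxCountK k n ((n : ℝ) / (3 * ((k : ℝ) - 1))) P) (x : Fin (k - 1) → ℕ) :
    3 * phiK P n x ≤ 2 * n ∧ phiK P n x ≤ n - ∑ j, x j := by
  suffices phiK P n x ≤ min (2 * n / 3) (n - ∑ j, x j) by omega
  refine phiK_le_iff.2 fun v hv => ?_
  have hj j : 3 * (k - 1) * rectHi P n v j ≤ 2 * n + 3 * (k - 1) * rectLo P n v j := by
    obtain ⟨y, hy, hy'⟩ := exists_countK_eq_rectHi hP le_rfl v j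
    obtain ⟨z, hz, hz'⟩ := exists_countK_eq_rectLo hP le_rfl v j
    rw [← hy', ← hz']
    exact countK_le_of_state_eq hk hA (hy.trans hz.symm) _
  have hs := Finset.sum_le_sum fun j (_ : j ∈ Finset.univ) => hj j
  rw [Finset.sum_add_distrib, Finset.sum_const, ← Finset.mul_sum, ← Finset.mul_sum,
    Finset.card_univ, Fintype.card_fin, smul_eq_mul] at hs
  have hs' : (k - 1) * (3 * ∑ j, rectHi P n v j) ≤ (k - 1) * (2 * n + 3 * ∑ j, rectLo P n v j) := by
    linarith
  have := Nat.le_of_mul_le_mul_left hs' (by omega)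
  have := Finset.sum_le_sum fun j (_ : j ∈ Finset.univ) => (hv j).1
  omega

theorem two_le_width (hk : 2 ≤ k) (hn : 0 < n)
    (hA : ComputesApproxCountK k n ((n : ℝ) / (3 * ((k : ℝ) - 1))) P) : 2 ≤ P.width := by
  by_contra! h
  have hsize : P.size n ≤ 1 := (P.size_le_width le_rfl).trans (by omega)
  have hsub : Subsingleton (Fin (P.size n)) := Fin.subsingleton_iff_le_one.2 hsize
  have h := countK_le_of_state_eq hk hA (x := fun _ => ⟨0, by omega⟩) (y := fun _ => ⟨1, by omega⟩)
    (Subsingleton.elim _ _) ⟨0, by omega⟩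
  simp only [countK, Fin.mk.injEq, one_ne_zero, Finset.filter_true, Finset.filter_false,
    Finset.card_range, Finset.card_empty, mul_zero, add_zero] at h
  have : 1 * n ≤ (k - 1) * n := Nat.mul_le_mul_right n (by omega)
  linarith [mul_assoc 3 (k - 1) n]

end Rectangles

/-- By the reflection symmetry of a box, a point of it has on average coordinate sum
`m * a / 2`. -/
theorem mul_pow_le_two_mul_sum_sub {m a N : ℕ} (h : m * a ≤ N) :
    N * (a + 1) ^ m ≤ 2 * ∑ f : Fin m → Fin (a + 1), (N - ∑ j, (f j : ℕ)) := by
  have hrev : ∑ f : Fin m → Fin (a + 1), (N - ∑ j, (f j : ℕ))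
      = ∑ f : Fin m → Fin (a + 1), (N - ∑ j, ((f j).rev : ℕ)) :=
    (Equiv.sum_comp (Equiv.piCongrRight fun _ => Fin.revPerm)
      fun f : Fin m → Fin (a + 1) => N - ∑ j, (f j : ℕ)).symm
  have hpt (f : Fin m → Fin (a + 1)) :
      N ≤ (N - ∑ j, (f j : ℕ)) + (N - ∑ j, ((f j).rev : ℕ)) := by
    have : ∑ j, (f j : ℕ) + ∑ j, ((f j).rev : ℕ) = m * a := by
      rw [← Finset.sum_add_distrib, Finset.sum_congr rfl (g := fun _ => a), Finset.sum_const,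
        Finset.card_univ, Fintype.card_fin, smul_eq_mul]
      intro j _
      have := (f j).isLt
      rw [Fin.val_rev]
      omega
    omega
  calc N * (a + 1) ^ m = ∑ _f : Fin m → Fin (a + 1), N := by
        simp [mul_comm]
    _ ≤ _ := Finset.sum_le_sum fun f _ => hpt f
    _ = _ := by rw [Finset.sum_add_distrib, ← hrev, two_mul]

/-- The main counting bound: the width is at least `(a + 1) ^ (k - 1) / 6`. -/
theorem pow_le_six_mul_width {k n a : ℕ} {P : ROBP (Fin k) (Fin k → ℝ) n} (hk : 2 ≤ k)
    (hn : 0 < n) (hP : P.Reachable)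
    (hA : ComputesApproxCountK k n ((n : ℝ) / (3 * ((k : ℝ) - 1))) P)
    (ha : (k - 1) * a ≤ n - 2 * n / 3) : (a + 1) ^ (k - 1) ≤ 6 * P.width := by
  classical
  let e : (Fin (k - 1) → Fin (a + 1)) ↪ (Fin (k - 1) → ℕ) :=
    ⟨fun f j => f j, fun f g h => funext fun j => Fin.ext (congrFun h j)⟩
  have h1 := sum_sub_le_width_mul_add_sum_phiK (by omega) hP (Finset.univ.map e) le_rfl
  rw [Finset.sum_map, Finset.sum_map] at h1
  have h2 : ∑ f, phiK P n (e f) + ∑ f, (n - 2 * n / 3 - ∑ j, e f j) ≤ ∑ f, (n - ∑ j, e f j) := by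
    rw [← Finset.sum_add_distrib]
    refine Finset.sum_le_sum fun f _ => ?_
    have := phiK_final_le hk hP hA (e f)
    omega
  have h3 : (n - 2 * n / 3) * (a + 1) ^ (k - 1) ≤ 2 * ∑ f, (n - 2 * n / 3 - ∑ j, e f j) :=
    mul_pow_le_two_mul_sum_sub ha
  have h4 : n * (a + 1) ^ (k - 1) ≤ 3 * ((n - 2 * n / 3) * (a + 1) ^ (k - 1)) := by
    rw [← mul_assoc]
    exact Nat.mul_le_mul_right _ (by omega)
  refine Nat.le_of_mul_le_mul_left (c := n) ?_ hn
  rw [mul_left_comm]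
  omega

/-- there is an absolute constant `c > 0` such that for all `k ≥ 2` and
`n ≥ 3k`, any length-`n` ROBP over `[k]` computing `ApproxCount_k[n, n/(3(k-1))]`
has width `w` with `log₂ w ≥ c · k · log₂(n/k)`. -/
theorem stmt8 :
    ∃ c : ℝ, 0 < c ∧
      ∀ k n : ℕ, 2 ≤ k → 3 * k ≤ n →
        ∀ P : ROBP (Fin k) (Fin k → ℝ) n, P.Reachable →
          ComputesApproxCountK k n ((n : ℝ) / (3 * ((k : ℝ) - 1))) P →
          Real.logb 2 (P.width : ℝ) ≥ c * (k : ℝ) * Real.logb 2 ((n : ℝ) / (k : ℝ)) := by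
  refine ⟨1 / 30, by norm_num, fun k n hk hn P hP hA => ?_⟩
  obtain ⟨a, ha⟩ : ∃ a, a = (n - 2 * n / 3 - 1) / (k - 1) := ⟨_, rfl⟩
  have ha1 : 1 ≤ a := by
    rw [ha, Nat.le_div_iff_mul_le (by omega)]
    omega
  have hale : (k - 1) * a ≤ n - 2 * n / 3 - 1 := by
    rw [ha]
    exact Nat.mul_div_le _ _
  have hlt : n - 2 * n / 3 - 1 < (k - 1) * (a + 1) := by
    rw [ha]
    exact Nat.lt_mul_div_succ _ (by omega)
  have hpow := pow_le_six_mul_width hk (by omega) hP hA (a := a) (by omega)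
  have hn_le : n ≤ 3 * (a + 1) * k := by
    have : (k - 1) * (a + 1) ≤ k * (a + 1) := Nat.mul_le_mul_right _ (by omega)
    have : 3 * (a + 1) * k = 3 * (k * (a + 1)) := by ring
    omega
  have hw : (2 : ℝ) ≤ P.width := by exact_mod_cast two_le_width hk (by omega) hA
  have hk0 : (2 : ℝ) ≤ k := by exact_mod_cast hk
  have hA2 : (2 : ℝ) ≤ (a : ℝ) + 1 := by
    have : (1 : ℝ) ≤ a := by exact_mod_cast ha1
    linarith
  have hr : (n : ℝ) / k ≤ ((a : ℝ) + 1) ^ 3 := by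
    have h1 : (n : ℝ) / k ≤ 3 * ((a : ℝ) + 1) := by
      rw [div_le_iff₀ (by linarith)]
      exact_mod_cast hn_le
    nlinarith [mul_nonneg (sub_nonneg.2 hA2) (sub_nonneg.2 hA2)]
  have hr0 : 0 < (n : ℝ) / k := by
    have : (0 : ℝ) < n := by exact_mod_cast (by omega : 0 < n)
    positivity
  have hL : Real.log ((n : ℝ) / k) ≤ 3 * Real.log ((a : ℝ) + 1) := by
    have := Real.log_le_log hr0 hr
    rwa [Real.log_pow, Nat.cast_ofNat] at this
  have hlogA : 0 ≤ Real.log ((a : ℝ) + 1) := Real.log_nonneg (by linarith)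
  have hlogw : ((k : ℝ) - 1) * Real.log ((a : ℝ) + 1) ≤ Real.log 6 + Real.log P.width := by
    have h1 : ((a : ℝ) + 1) ^ (k - 1) ≤ 6 * P.width := by exact_mod_cast hpow
    have h2 := Real.log_le_log (by positivity) h1
    rwa [Real.log_pow, Real.log_mul (by norm_num) (by linarith),
      Nat.cast_sub (by omega), Nat.cast_one] at h2
  have hlog2 : Real.log 2 ≤ Real.log P.width := Real.log_le_log (by norm_num) hw
  have hlog6 : Real.log 6 ≤ 3 * Real.log 2 := by
    rw [← Nat.cast_ofNat (n := 3), ← Real.log_pow]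
    exact Real.log_le_log (by norm_num) (by norm_num)
  have hmain : 1 / 30 * (k : ℝ) * Real.log ((n : ℝ) / k) ≤ Real.log P.width := by
    have h1 : (k : ℝ) * Real.log ((n : ℝ) / k) ≤ k * (3 * Real.log ((a : ℝ) + 1)) :=
      mul_le_mul_of_nonneg_left hL (by linarith)
    have h2 : 0 ≤ ((k : ℝ) - 2) * Real.log ((a : ℝ) + 1) := mul_nonneg (by linarith) hlogA
    linarith
  have hlog2pos : 0 < Real.log 2 := Real.log_pos (by norm_num)
  rw [ge_iff_le, Real.logb, Real.logb, ← mul_div_assoc]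
  exact div_le_div_of_nonneg_right hmain hlog2pos.le
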